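/- Let ω*_f = ω_GMV + (β' A_φ⁻¹ β) Q μ be the mimicking optimal fund portfolio and let 𝒲 be the k×n matrix whose i-th column is the non-mimicking individual optimum ωᵢ = ω_GMV + αᵢ⁻¹ Q μ. Then the aggregated mimicking objective EU*(W) = β'W'μ − (1/2) tr(A W'ΣW) evaluated at the mimicking optimum W* = ω_GMV 1_n' + (Qμ)(β' A_φ⁻¹) satisfies EU*(W*) ≥ EU*(𝒲); i.e. investors willing to mimic attain at least as high an aggregated objective through the fund's solution as through their individually feasible non-mimicking portfolios. -/

import Mathlib

open Matrix BigOperators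

lemma aux_trace {k n : ℕ} (A : Matrix (Fin n) (Fin n) ℝ) (S : Matrix (Fin k) (Fin k) ℝ)
    (x v : Fin n → ℝ) (g q : Fin k → ℝ) :
    (A * vecMulVec x g * S * vecMulVec q v).trace = (g ⬝ᵥ (S *ᵥ q)) * (v ⬝ᵥ (A *ᵥ x)) := by
  rw [Matrix.mul_assoc, Matrix.mul_vecMulVec, Matrix.mul_vecMulVec,
    Matrix.vecMulVec_mul_vecMulVec, Matrix.trace_vecMulVec]
  simp [dotProduct_comm]

lemma aux_EU {k n : ℕ} (A : Matrix (Fin n) (Fin n) ℝ) (S : Matrix (Fin k) (Fin k) ℝ)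
    (o v β : Fin n → ℝ) (g q μ : Fin k → ℝ) (s : ℝ)
    (h1 : g ⬝ᵥ (S *ᵥ q) = 0) (h2 : q ⬝ᵥ (S *ᵥ g) = 0) (h3 : q ⬝ᵥ (S *ᵥ q) = s)
    (h4 : q ⬝ᵥ μ = s) :
    β ⬝ᵥ ((vecMulVec g o + vecMulVec q v)ᵀ *ᵥ μ) - (1 / 2) *
      (A * (vecMulVec g o + vecMulVec q v)ᵀ * S * (vecMulVec g o + vecMulVec q v)).trace
    = (β ⬝ᵥ o) * (g ⬝ᵥ μ) - (1 / 2) * ((g ⬝ᵥ (S *ᵥ g)) * (o ⬝ᵥ (A *ᵥ o)))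
      + s * (β ⬝ᵥ v - (1 / 2) * (v ⬝ᵥ (A *ᵥ v))) := by
  rw [Matrix.transpose_add, Matrix.transpose_vecMulVec, Matrix.transpose_vecMulVec]
  simp only [Matrix.mul_add, Matrix.add_mul, Matrix.trace_add, aux_trace, h1, h2, h3,
    Matrix.add_mulVec, Matrix.vecMulVec_mulVec, dotProduct_add]
  simp [h4]
  ring

lemma aux_quad {n : ℕ} (α β φ : Fin n → ℝ) (hβsum : ∑ i, β i = 1) (x : Fin n → ℝ) :
    x ⬝ᵥ (((Matrix.diagonal α + Matrix.diagonal φ) * Matrix.diagonal β +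
      ((∑ i, β i * φ i) • (1 : Matrix (Fin n) (Fin n) ℝ) - 2 • Matrix.diagonal φ) *
        vecMulVec β β) *ᵥ x)
    = ∑ i, α i * β i * x i ^ 2 + ∑ i, β i * φ i * (x i - β ⬝ᵥ x) ^ 2 := by
  set m := β ⬝ᵥ x with hm
  set f := ∑ i, β i * φ i with hf
  have e1 : ∀ i, (((Matrix.diagonal α + Matrix.diagonal φ) * Matrix.diagonal β +
      (f • (1 : Matrix (Fin n) (Fin n) ℝ) - 2 • Matrix.diagonal φ) *
        vecMulVec β β) *ᵥ x) i = (α i + φ i) * β i * x i + (f - 2 * φ i) * β i * m := by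
    intro i
    rw [Matrix.add_mulVec, ← Matrix.mulVec_mulVec, ← Matrix.mulVec_mulVec,
      Matrix.vecMulVec_mulVec, ← hm]
    simp [two_mul, two_smul, Matrix.add_mulVec, Matrix.sub_mulVec, Matrix.smul_mulVec, Matrix.mulVec_diagonal]
    ring
  have e2 : m = ∑ i, β i * x i := rfl
  simp only [dotProduct, e1]
  have e3 : ∑ i, β i * φ i * (x i - m) ^ 2 =
      ∑ i, (β i * φ i * x i ^ 2 - 2 * m * (β i * φ i * x i)) + m ^ 2 * f := by
    rw [hf, Finset.mul_sum, ← Finset.sum_add_distrib]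
    exact Finset.sum_congr rfl fun i _ => by ring
  have e4 : m ^ 2 * f = ∑ i, m * f * (β i * x i) := by
    rw [← Finset.mul_sum, ← e2]; ring
  rw [e3, e4, ← Finset.sum_add_distrib, ← Finset.sum_add_distrib]
  exact Finset.sum_congr rfl fun i _ => by ring

lemma aux_opt {n : ℕ} (A : Matrix (Fin n) (Fin n) ℝ) (β v : Fin n → ℝ)
    (hA : ∀ x, x ≠ 0 → 0 < x ⬝ᵥ (A *ᵥ x)) :
    β ⬝ᵥ v - (1 / 2) * (v ⬝ᵥ (A *ᵥ v)) ≤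
      β ⬝ᵥ (β ᵥ* ((1 / 2 : ℝ) • (A + Aᵀ))⁻¹) - (1 / 2) *
        ((β ᵥ* ((1 / 2 : ℝ) • (A + Aᵀ))⁻¹) ⬝ᵥ (A *ᵥ (β ᵥ* ((1 / 2 : ℝ) • (A + Aᵀ))⁻¹))) := by
  set M := (1 / 2 : ℝ) • (A + Aᵀ) with hM
  have hT : ∀ x y : Fin n → ℝ, x ⬝ᵥ (Aᵀ *ᵥ y) = y ⬝ᵥ (A *ᵥ x) := by
    intro x y
    rw [Matrix.mulVec_transpose, dotProduct_comm, ← Matrix.dotProduct_mulVec]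
  have hxy : ∀ x y : Fin n → ℝ,
      x ⬝ᵥ (M *ᵥ y) = (1 / 2) * (x ⬝ᵥ (A *ᵥ y) + y ⬝ᵥ (A *ᵥ x)) := by
    intro x y
    rw [hM, Matrix.smul_mulVec, Matrix.add_mulVec, dotProduct_smul, dotProduct_add, hT]
    simp
  have hsym : Mᵀ = M := by
    rw [hM, Matrix.transpose_smul, Matrix.transpose_add, Matrix.transpose_transpose, add_comm]
  have hpd : M.PosDef := by
    refine Matrix.PosDef.of_dotProduct_mulVec_pos ?_ ?_
    · rw [Matrix.IsHermitian, Matrix.conjTranspose_eq_transpose_of_trivial, hsym]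
    · intro x hx
      have := hA x hx
      rw [star_trivial, hxy]; linarith
  set w := β ᵥ* M⁻¹ with hw
  have hMw : w ᵥ* M = β := by
    rw [hw, Matrix.vecMul_vecMul, Matrix.nonsing_inv_mul _ ((Matrix.isUnit_iff_isUnit_det M).1 hpd.isUnit),
      Matrix.vecMul_one]
  have hb : ∀ x, β ⬝ᵥ x = (1 / 2) * (w ⬝ᵥ (A *ᵥ x) + x ⬝ᵥ (A *ᵥ w)) := by
    intro x
    rw [← hxy, Matrix.dotProduct_mulVec, hMw]
  have hnn : 0 ≤ (v - w) ⬝ᵥ (A *ᵥ (v - w)) := by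
    by_cases h : v - w = 0
    · simp [h]
    · exact (hA _ h).le
  rw [Matrix.mulVec_sub, sub_dotProduct, dotProduct_sub, dotProduct_sub] at hnn
  rw [hb v, hb w]
  linarith

/-- The aggregated mimicking objective `EU*(W) = β'W'μ − (1/2) tr(A W'ΣW)`
evaluated at the mimicking optimum `W* = ω_GMV 1_n' + (Qμ)(β' A_φ⁻¹)` is at least its value
at the matrix `𝒲` of non-mimicking individual optima `ωᵢ = ω_GMV + αᵢ⁻¹ Q μ`. -/
theorem mimicking_optimum_dominates_individual_optima
    {k n : ℕ} (hk : 2 ≤ k) (hn : 2 ≤ n)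
    (S : Matrix (Fin k) (Fin k) ℝ) (hS : S.PosDef)
    (μ : Fin k → ℝ)
    (α β φ : Fin n → ℝ)
    (hα : ∀ i, 0 < α i) (hβ : ∀ i, 0 < β i) (hβsum : ∑ i, β i = 1)
    (hφ : ∀ i, 0 < φ i) :
    let onek : Fin k → ℝ := fun _ => 1
    let onen : Fin n → ℝ := fun _ => 1
    let c : ℝ := onek ⬝ᵥ (S⁻¹ *ᵥ onek)
    let ωGMV : Fin k → ℝ := c⁻¹ • (S⁻¹ *ᵥ onek)
    let Q : Matrix (Fin k) (Fin k) ℝ := S⁻¹ - c⁻¹ • vecMulVec (S⁻¹ *ᵥ onek) (onek ᵥ* S⁻¹)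
    let A₀ : Matrix (Fin n) (Fin n) ℝ := Matrix.diagonal α
    let B : Matrix (Fin n) (Fin n) ℝ := Matrix.diagonal β
    let Φ : Matrix (Fin n) (Fin n) ℝ := Matrix.diagonal φ
    let φbar : ℝ := ∑ i, β i * φ i
    let A : Matrix (Fin n) (Fin n) ℝ :=
      (A₀ + Φ) * B + (φbar • (1 : Matrix (Fin n) (Fin n) ℝ) - 2 • Φ) * vecMulVec β β
    let Aφ : Matrix (Fin n) (Fin n) ℝ := (1 / 2 : ℝ) • (A + Aᵀ)
    let Wstar : Matrix (Fin k) (Fin n) ℝ :=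
      vecMulVec ωGMV onen + vecMulVec (Q *ᵥ μ) (β ᵥ* Aφ⁻¹)
    let Wind : Matrix (Fin k) (Fin n) ℝ :=
      vecMulVec ωGMV onen + vecMulVec (Q *ᵥ μ) (fun i => (α i)⁻¹)
    let EU : Matrix (Fin k) (Fin n) ℝ → ℝ :=
      fun W => β ⬝ᵥ (Wᵀ *ᵥ μ) - (1 / 2) * (A * Wᵀ * S * W).trace
    EU Wind ≤ EU Wstar := by
  intro onek onen c ωGMV Q A₀ B Φ φbar A Aφ Wstar Wind EU
  have hdet : IsUnit S.det := (Matrix.isUnit_iff_isUnit_det S).1 hS.isUnit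
  have hSi : S⁻¹.PosDef := hS.inv
  have hST : Sᵀ = S := by
    have := hS.isHermitian
    rwa [Matrix.IsHermitian, Matrix.conjTranspose_eq_transpose_of_trivial] at this
  have hSiT : S⁻¹ᵀ = S⁻¹ := by rw [Matrix.transpose_nonsing_inv, hST]
  have hone : onek ≠ 0 := by
    intro h
    have := congrFun h ⟨0, by omega⟩
    simp [onek] at this
  have hc : 0 < c := by
    have := hSi.dotProduct_mulVec_pos hone
    rwa [star_trivial] at this
  set u := S⁻¹ *ᵥ onek with hu
  have hu' : onek ᵥ* S⁻¹ = u := by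
    rw [hu, ← Matrix.vecMul_transpose, hSiT]
  have hcu : onek ⬝ᵥ u = c := rfl
  set q := Q *ᵥ μ with hqd
  have hq : q = S⁻¹ *ᵥ μ - (c⁻¹ * (u ⬝ᵥ μ)) • u := by
    simp only [hqd, Q, hu', Matrix.sub_mulVec, Matrix.smul_mulVec, Matrix.vecMulVec_mulVec]
    ext i; simp; ring
  have h1q : onek ⬝ᵥ q = 0 := by
    rw [hq, dotProduct_sub, Matrix.dotProduct_mulVec, hu', dotProduct_smul, hcu, smul_eq_mul]
    field_simp
    ring
  have hSu : S *ᵥ u = onek := by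
    rw [hu, Matrix.mulVec_mulVec, Matrix.mul_nonsing_inv _ hdet, Matrix.one_mulVec]
  have hSq : S *ᵥ q = μ - (c⁻¹ * (u ⬝ᵥ μ)) • onek := by
    rw [hq, Matrix.mulVec_sub, Matrix.mulVec_smul, hSu, Matrix.mulVec_mulVec,
      Matrix.mul_nonsing_inv _ hdet, Matrix.one_mulVec]
  have h2 : q ⬝ᵥ (S *ᵥ ωGMV) = 0 := by
    simp only [ωGMV, Matrix.mulVec_smul, dotProduct_smul]
    rw [← hu, hSu, dotProduct_comm, h1q, smul_zero]
  have h1 : ωGMV ⬝ᵥ (S *ᵥ q) = 0 := by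
    rw [Matrix.dotProduct_mulVec, ← Matrix.mulVec_transpose, hST, dotProduct_comm, h2]
  have h3 : q ⬝ᵥ (S *ᵥ q) = q ⬝ᵥ μ := by
    rw [hSq, dotProduct_sub, dotProduct_smul, dotProduct_comm q onek, h1q, smul_zero, sub_zero]
  have hs : 0 ≤ q ⬝ᵥ μ := by
    rw [← h3]
    have := hS.posSemidef.dotProduct_mulVec_nonneg q
    rwa [star_trivial] at this
  have hA : ∀ x, x ≠ 0 → 0 < x ⬝ᵥ (A *ᵥ x) := by
    intro x hx
    have e : x ⬝ᵥ (A *ᵥ x) = _ := aux_quad α β φ hβsum x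
    rw [e]
    obtain ⟨j, hj⟩ := Function.ne_iff.1 hx
    have p1 : 0 < ∑ i, α i * β i * x i ^ 2 := by
      refine Finset.sum_pos' (fun i _ => ?_) ⟨j, Finset.mem_univ _, ?_⟩
      · have := hα i; have := hβ i; positivity
      · have := hα j; have := hβ j
        have : 0 < x j ^ 2 := by
          have : x j ≠ 0 := hj
          positivity
        positivity
    have p2 : 0 ≤ ∑ i, β i * φ i * (x i - β ⬝ᵥ x) ^ 2 := by
      refine Finset.sum_nonneg fun i _ => ?_
      have := hφ i; have := hβ i; positivity
    linarith
  have E1 : EU Wind = _ := aux_EU A S onen (fun i => (α i)⁻¹) β ωGMV q μ _ h1 h2 h3 rfl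
  have E2 : EU Wstar = _ := aux_EU A S onen (β ᵥ* Aφ⁻¹) β ωGMV q μ _ h1 h2 h3 rfl
  rw [E1, E2]
  have := mul_le_mul_of_nonneg_left (aux_opt A β (fun i => (α i)⁻¹) hA) hs
  exact add_le_add le_rfl this
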